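/- arXiv:2103.02281 — 2 statements merged into one kernel-verified Lean document; each statement's English description precedes it below -/
import Mathlib

section
/- If in addition 𝒰 is compact, then for every η > 0 the regularized pessimistic bilevel problem min_{u ∈ 𝒰} Φ_η[u], with Φ_η[u] := sup_{f ∈ Ψ_η[u]} J[u,f], has an optimal solution, i.e. there exists u* ∈ 𝒰 with Φ_η[u*] ≤ Φ_η[u] for all u ∈ 𝒰. -/
open Matrix Set

/-- The lower-level quadratic objective `f ↦ fᵀ M H[u]⁻¹ M f`. -/
noncomputable def lowerObj {n N : ℕ} (M : Matrix (Fin N) (Fin N) ℝ)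
    (H : (Fin n → ℝ) → Matrix (Fin N) (Fin N) ℝ)
    (u : Fin n → ℝ) (f : Fin N → ℝ) : ℝ :=
  f ⬝ᵥ ((M * (H u)⁻¹ * M) *ᵥ f)

/-- The lower-level optimal value function `ψ[u] = max_{f ∈ ℱ} fᵀ M H[u]⁻¹ M f`. -/
noncomputable def psiVal {n N : ℕ} (M : Matrix (Fin N) (Fin N) ℝ)
    (H : (Fin n → ℝ) → Matrix (Fin N) (Fin N) ℝ)
    (F : Set (Fin N → ℝ)) (u : Fin n → ℝ) : ℝ :=
  sSup (lowerObj M H u '' F)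

/-- The lower-level solution set mapping `Ψ[u] = {f ∈ ℱ : fᵀ M H[u]⁻¹ M f = ψ[u]}`. -/
noncomputable def PsiSet {n N : ℕ} (M : Matrix (Fin N) (Fin N) ℝ)
    (H : (Fin n → ℝ) → Matrix (Fin N) (Fin N) ℝ)
    (F : Set (Fin N → ℝ)) (u : Fin n → ℝ) : Set (Fin N → ℝ) :=
  {f ∈ F | lowerObj M H u f = psiVal M H F u}

/-- The pessimistic value function `Φ[u] = max_{f ∈ Ψ[u]} J[u,f]`. -/
noncomputable def PhiVal {n N : ℕ} (M : Matrix (Fin N) (Fin N) ℝ)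
    (H : (Fin n → ℝ) → Matrix (Fin N) (Fin N) ℝ)
    (F : Set (Fin N → ℝ)) (J : (Fin n → ℝ) → (Fin N → ℝ) → ℝ)
    (u : Fin n → ℝ) : ℝ :=
  sSup ((J u) '' PsiSet M H F u)

/-- The set of `η`-optimal lower-level solutions
`Ψ_η[u] = {f ∈ ℱ : ψ[u] - fᵀ M H[u]⁻¹ M f < η}`. -/
noncomputable def PsiEta {n N : ℕ} (M : Matrix (Fin N) (Fin N) ℝ)
    (H : (Fin n → ℝ) → Matrix (Fin N) (Fin N) ℝ)
    (F : Set (Fin N → ℝ)) (η : ℝ) (u : Fin n → ℝ) : Set (Fin N → ℝ) :=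
  {f ∈ F | psiVal M H F u - lowerObj M H u f < η}

/-- The regularized pessimistic value function `Φ_η[u] = sup_{f ∈ Ψ_η[u]} J[u,f]`. -/
noncomputable def PhiEta {n N : ℕ} (M : Matrix (Fin N) (Fin N) ℝ)
    (H : (Fin n → ℝ) → Matrix (Fin N) (Fin N) ℝ)
    (F : Set (Fin N → ℝ)) (J : (Fin n → ℝ) → (Fin N → ℝ) → ℝ)
    (η : ℝ) (u : Fin n → ℝ) : ℝ :=
  sSup ((J u) '' PsiEta M H F η u)

/-- Inversion preserves continuity of matrix functions with invertible values. -/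
theorem Matrix.continuous_inv_of_isUnit_det {X m : Type*} [TopologicalSpace X] [Fintype m]
    [DecidableEq m] {A : X → Matrix m m ℝ} (hA : Continuous A) (hdet : ∀ x, IsUnit (A x).det) :
    Continuous fun x => (A x)⁻¹ := by
  simp only [Matrix.inv_def, Ring.inverse_eq_inv']
  exact (hA.matrix_det.inv₀ fun x => (hdet x).ne_zero).smul hA.matrix_adjugate

section Continuity

variable {n N : ℕ} (M : Matrix (Fin N) (Fin N) ℝ)
  {H : (Fin n → ℝ) → Matrix (Fin N) (Fin N) ℝ} {U : Set (Fin n → ℝ)}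

theorem continuous_lowerObj (hHcont : ContinuousOn H U) (hHpd : ∀ u ∈ U, (H u).PosDef) :
    Continuous fun p : U × (Fin N → ℝ) => lowerObj M H p.1 p.2 := by
  have hinv : Continuous fun u : U => (H u)⁻¹ :=
    Matrix.continuous_inv_of_isUnit_det hHcont.domRestrict
      fun u => (hHpd u u.2).det_pos.ne'.isUnit
  have hinv' : Continuous fun p : U × (Fin N → ℝ) => (H p.1)⁻¹ := hinv.comp continuous_fst
  unfold lowerObj
  exact continuous_snd.dotProduct
    (((continuous_const.matrix_mul hinv').matrix_mul continuous_const).matrix_mulVec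
      continuous_snd)

theorem continuous_psiVal (hHcont : ContinuousOn H U) (hHpd : ∀ u ∈ U, (H u).PosDef)
    {F : Set (Fin N → ℝ)} (hF : IsCompact F) :
    Continuous fun u : U => psiVal M H F u :=
  hF.continuous_sSup (f := fun (u : U) f => lowerObj M H u f)
    (continuous_lowerObj M hHcont hHpd)

theorem PsiEta_nonempty
    {F : Set (Fin N → ℝ)} (hFne : F.Nonempty) {η : ℝ} (hη : 0 < η)
    {u : Fin n → ℝ} : (PsiEta M H F η u).Nonempty := by
  obtain ⟨_, ⟨f, hf, rfl⟩, hlt⟩ := exists_lt_of_lt_csSup (hFne.image (lowerObj M H u))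
    (sub_lt_self (psiVal M H F u) hη)
  exact ⟨f, hf, by linarith⟩

/-- The regularized pessimistic value function is lower semicontinuous. -/
theorem lowerSemicontinuous_PhiEta (hHcont : ContinuousOn H U) (hHpd : ∀ u ∈ U, (H u).PosDef)
    {F : Set (Fin N → ℝ)} (hFne : F.Nonempty) (hF : IsCompact F)
    {J : (Fin n → ℝ) → (Fin N → ℝ) → ℝ}
    (hJ : ContinuousOn (fun p : (Fin n → ℝ) × (Fin N → ℝ) => J p.1 p.2) (U ×ˢ Set.univ))
    {η : ℝ} (hη : 0 < η) :
    LowerSemicontinuous fun u : U => PhiEta M H F J η u := by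
  have hJ' : Continuous fun p : U × (Fin N → ℝ) => J p.1 p.2 :=
    hJ.comp_continuous (f := fun p : U × (Fin N → ℝ) => ((p.1 : Fin n → ℝ), p.2))
      (by fun_prop) fun p => ⟨p.1.2, mem_univ _⟩
  intro u y hy
  obtain ⟨_, ⟨f, ⟨hfF, hfη⟩, rfl⟩, hyf⟩ :=
    exists_lt_of_lt_csSup ((PsiEta_nonempty M hFne hη).image (J u)) hy
  have hgap : Continuous fun v : U => psiVal M H F v - lowerObj M H v f :=
    (continuous_psiVal M hHcont hHpd hF).sub
      ((continuous_lowerObj M hHcont hHpd).comp (Continuous.prodMk_left f))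
  have hJf : Continuous fun v : U => J v f := hJ'.comp (Continuous.prodMk_left f)
  filter_upwards [hgap.continuousAt.eventually_lt_const hfη,
    hJf.continuousAt.eventually_const_lt hyf] with v hvη hyv
  have hbdd : BddAbove (J v '' PsiEta M H F η v) :=
    (hF.bddAbove_image (hJ'.comp (Continuous.prodMk_right v)).continuousOn).mono
      (image_mono (sep_subset _ _))
  exact hyv.trans_le (le_csSup hbdd ⟨f, ⟨hfF, hvη⟩, rfl⟩)

end Continuity

theorem stmt9 (n N : ℕ) (hn : 0 < n) (hN : 0 < N)
    (U : Set (Fin n → ℝ)) (hUpos : ∀ u ∈ U, ∀ i, 0 < u i)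
    (hUne : U.Nonempty) (hUcl : IsClosed U)
    (M : Matrix (Fin N) (Fin N) ℝ) (hM : M.PosDef)
    (F : Set (Fin N → ℝ)) (hFne : F.Nonempty) (hFconv : Convex ℝ F)
    (hFcomp : IsCompact F)
    (H : (Fin n → ℝ) → Matrix (Fin N) (Fin N) ℝ)
    (hHcont : ContinuousOn H U) (hHpd : ∀ u ∈ U, (H u).PosDef)
    (J : (Fin n → ℝ) → (Fin N → ℝ) → ℝ)
    (hJ : ContinuousOn (fun p : (Fin n → ℝ) × (Fin N → ℝ) => J p.1 p.2)
      (U ×ˢ Set.univ))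
    (hUcomp : IsCompact U) :
    ∀ η : ℝ, 0 < η →
      ∃ ustar ∈ U, ∀ u ∈ U, PhiEta M H F J η ustar ≤ PhiEta M H F J η u := by
  intro η hη
  have : CompactSpace U := isCompact_iff_compactSpace.mp hUcomp
  have : Nonempty U := hUne.to_subtype
  have hlsc : LowerSemicontinuousOn (fun u : U => PhiEta M H F J η u) univ :=
    (lowerSemicontinuous_PhiEta M hHcont hHpd hFne hFcomp hJ hη).lowerSemicontinuousOn univ
  obtain ⟨u, -, hu⟩ := hlsc.exists_isMinOn univ_nonempty isCompact_univ
  exact ⟨u, u.2, fun v hv => isMinOn_iff.mp hu ⟨v, hv⟩ (mem_univ _)⟩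
end

section
/- Assume ℱ is a bounded polyhedron, i.e. the convex hull of its nonempty finite set of extreme points 𝒫, and that there is an open connected set Ũ ⊆ ℝ^n with 𝒰 ⊆ Ũ on which H is real analytic with values in a closed subset of the symmetric positive definite matrices. Then the set of points of 𝒰 at which the pessimistic value function Φ[u] := max_{f ∈ Ψ[u]} J[u,f] fails to be continuous (relative to 𝒰) has Lebesgue measure zero in ℝ^n. -/
open Matrix Set

open MeasureTheory Metric Filter Topology in
/-- A measurable set is null as soon as almost every point of each ray from the origin
lies outside of it. -/
theorem measure_eq_zero_of_forall_ray {E : Type*} [NormedAddCommGroup E] [NormedSpace ℝ E]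
    [MeasurableSpace E] [BorelSpace E] [FiniteDimensional ℝ E] [Nontrivial E]
    (μ : Measure E) [μ.IsAddHaarMeasure] {S : Set E} (hS : MeasurableSet S)
    (h : ∀ v ∈ sphere (0 : E) 1, volume {r : ℝ | r • v ∈ S} = 0) : μ S = 0 := by
  have hcomap : μ.comap ((↑) : ({0}ᶜ : Set E) → E) ((↑) ⁻¹' S) = 0 := by
    have hpre : ((↑) : ({0}ᶜ : Set E) → E) ⁻¹' S = homeomorphUnitSphereProd E ⁻¹'
        ((fun p => (((homeomorphUnitSphereProd E).symm p : ({0}ᶜ : Set E)) : E)) ⁻¹' S) := by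
      rw [preimage_preimage]
      simp only [Homeomorph.symm_apply_apply]
    have hmeas : MeasurableSet
        ((fun p => (((homeomorphUnitSphereProd E).symm p : ({0}ᶜ : Set E)) : E)) ⁻¹' S) :=
      (measurable_subtype_coe.comp (homeomorphUnitSphereProd E).symm.measurable) hS
    rw [hpre, μ.measurePreserving_homeomorphUnitSphereProd.measure_preimage
      hmeas.nullMeasurableSet, Measure.measure_prod_null hmeas]
    refine ae_of_all _ fun v => ?_
    refine withDensity_absolutelyContinuous _ _ ?_
    rw [comap_subtype_coe_apply measurableSet_Ioi]
    refine measure_mono_null ?_ (h v v.2)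
    rintro _ ⟨r, hr, rfl⟩
    simpa using hr
  rw [comap_subtype_coe_apply (measurableSet_singleton _).compl, Subtype.image_preimage_coe]
    at hcomap
  refine measure_mono_null (t := {0} ∪ {0}ᶜ ∩ S) (fun x hx => ?_)
    (measure_union_null (measure_singleton _) hcomap)
  by_cases hx0 : x = 0
  · exact Or.inl hx0
  · exact Or.inr ⟨hx0, hx⟩

open MeasureTheory Filter Topology in
/-- The zero set of a one-variable real analytic function that does not vanish identically on a
preconnected set is null. -/
theorem AnalyticOnNhd.volume_zeros_eq_zero {g : ℝ → ℝ} {I : Set ℝ} (hI : MeasurableSet I)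
    (hIc : IsPreconnected I) (hg : AnalyticOnNhd ℝ g I) {t₀ : ℝ} (ht₀ : t₀ ∈ I)
    (hgt₀ : g t₀ ≠ 0) : volume {t ∈ I | g t = 0} = 0 := by
  have hcod : {t | g t ≠ 0} ∈ codiscreteWithin I := by
    rw [mem_codiscreteWithin]
    intro x hx
    rw [disjoint_principal_right]
    rcases (hg x hx).eventually_eq_zero_or_eventually_ne_zero with h0 | h0
    · exact absurd (hg.eqOn_zero_of_preconnected_of_eventuallyEq_zero hIc hx h0 ht₀) hgt₀
    · filter_upwards [h0] with t ht
      simp [ht]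
  have hae := ae_restrict_le_codiscreteWithin (μ := volume) hI hcod
  rw [mem_ae_iff, Measure.restrict_apply' hI] at hae
  refine measure_mono_null (fun t ht => ?_) hae
  exact ⟨by simpa using ht.2, ht.1⟩

open MeasureTheory Metric Filter Topology in
/-- The zero set, inside a ball, of a real analytic function that does not vanish at the centre of
the ball is null. -/
theorem AnalyticOnNhd.measure_zeros_ball_eq_zero {E : Type*} [NormedAddCommGroup E]
    [NormedSpace ℝ E] [MeasurableSpace E] [BorelSpace E] [FiniteDimensional ℝ E] [Nontrivial E]
    (μ : Measure E) [μ.IsAddHaarMeasure] {f : E → ℝ} {x₀ : E} {ρ : ℝ} (hρ : 0 < ρ)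
    (hf : AnalyticOnNhd ℝ f (ball x₀ ρ)) (hfx₀ : f x₀ ≠ 0) :
    μ {x ∈ ball x₀ ρ | f x = 0} = 0 := by
  have hmeas : MeasurableSet {x ∈ ball x₀ ρ | f x = 0} := by
    have hopen : IsOpen (ball x₀ ρ ∩ f ⁻¹' {0}ᶜ) :=
      hf.continuousOn.isOpen_inter_preimage isOpen_ball isOpen_compl_singleton
    have heq : {x ∈ ball x₀ ρ | f x = 0} = ball x₀ ρ \ (ball x₀ ρ ∩ f ⁻¹' {0}ᶜ) := by
      ext x
      simp +contextual
    rw [heq]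
    exact measurableSet_ball.diff hopen.measurableSet
  rw [← measure_preimage_add μ x₀]
  refine measure_eq_zero_of_forall_ray μ (measurable_const_add x₀ hmeas) fun v _ => ?_
  set ℓ : ℝ → E := fun t => x₀ + t • v
  have hℓ : AnalyticOnNhd ℝ ℓ univ := fun t _ => by
    simp only [ℓ]
    fun_prop
  have hI : IsOpen (ℓ ⁻¹' ball x₀ ρ) := isOpen_ball.preimage (by fun_prop)
  have hconv : Convex ℝ (ℓ ⁻¹' ball x₀ ρ) :=
    ((convex_ball x₀ ρ).translate_preimage_right x₀).linear_preimage
      (LinearMap.toSpanSingleton ℝ E v)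
  exact AnalyticOnNhd.volume_zeros_eq_zero (g := f ∘ ℓ) (I := ℓ ⁻¹' ball x₀ ρ) (t₀ := 0)
    hI.measurableSet hconv.isPreconnected (fun t ht => (hf (ℓ t) ht).comp (hℓ t (mem_univ t)))
    (by simpa [ℓ] using hρ) (by simpa [ℓ] using hfx₀)

open MeasureTheory Metric Filter Topology in
/-- The zero set of a real analytic function on a preconnected open set is null, unless the
function vanishes identically. -/
theorem AnalyticOnNhd.eqOn_zero_or_measure_zeros_eq_zero {E : Type*} [NormedAddCommGroup E]
    [NormedSpace ℝ E] [MeasurableSpace E] [BorelSpace E] [FiniteDimensional ℝ E] [Nontrivial E]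
    (μ : Measure E) [μ.IsAddHaarMeasure] {f : E → ℝ} {U : Set E} (hU : IsOpen U)
    (hUc : IsPreconnected U) (hf : AnalyticOnNhd ℝ f U) :
    EqOn f 0 U ∨ μ {x ∈ U | f x = 0} = 0 := by
  refine or_iff_not_imp_left.2 fun hne => ?_
  have := FiniteDimensional.proper ℝ E
  refine measure_null_of_locally_null _ fun z hz => ?_
  obtain ⟨r, hr, hrU⟩ := Metric.isOpen_iff.1 hU z hz.1
  have hfreq : ∃ᶠ x in 𝓝 z, f x ≠ 0 := fun h =>
    hne (hf.eqOn_zero_of_preconnected_of_eventuallyEq_zero hUc hz.1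
      (h.mono fun x hx => not_not.1 hx))
  obtain ⟨x₀, hfx₀, hx₀⟩ := (hfreq.and_eventually (ball_mem_nhds z (half_pos hr))).exists
  have hsub : ball x₀ (r / 2) ⊆ U := by
    refine (ball_subset_ball' ?_).trans hrU
    linarith [hx₀.le]
  refine ⟨{x ∈ ball x₀ (r / 2) | f x = 0}, ?_,
    AnalyticOnNhd.measure_zeros_ball_eq_zero μ (half_pos hr) (hf.mono hsub) hfx₀⟩
  filter_upwards [self_mem_nhdsWithin,
    mem_nhdsWithin_of_mem_nhds (isOpen_ball.mem_nhds (mem_ball_comm.1 hx₀))] with x hx hxb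
  exact ⟨hxb, hx.2⟩

theorem AnalyticOnNhd.matrix_det {𝕜 E m : Type*} [NontriviallyNormedField 𝕜]
    [NormedAddCommGroup E] [NormedSpace 𝕜 E] [Fintype m] [DecidableEq m]
    {A : E → Matrix m m 𝕜} {U : Set E} (hA : ∀ i j, AnalyticOnNhd 𝕜 (fun u => A u i j) U) :
    AnalyticOnNhd 𝕜 (fun u => (A u).det) U := by
  simp only [Matrix.det_apply']
  exact Finset.analyticOnNhd_fun_sum _ fun σ _ =>
    analyticOnNhd_const.mul (Finset.analyticOnNhd_fun_prod _ fun i _ => hA _ _)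

theorem AnalyticOnNhd.matrix_inv {𝕜 E m : Type*} [NontriviallyNormedField 𝕜]
    [NormedAddCommGroup E] [NormedSpace 𝕜 E] [Fintype m] [DecidableEq m]
    {A : E → Matrix m m 𝕜} {U : Set E} (hA : ∀ i j, AnalyticOnNhd 𝕜 (fun u => A u i j) U)
    (hdet : ∀ u ∈ U, (A u).det ≠ 0) (i j : m) :
    AnalyticOnNhd 𝕜 (fun u => (A u)⁻¹ i j) U := by
  simp only [Matrix.inv_def, Matrix.smul_apply, smul_eq_mul, Ring.inverse_eq_inv',
    Matrix.adjugate_apply]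
  refine ((AnalyticOnNhd.matrix_det hA).inv hdet).mul (AnalyticOnNhd.matrix_det fun k l => ?_)
  simp only [Matrix.updateRow_apply]
  split_ifs
  · exact analyticOnNhd_const
  · exact hA k l

/-- A positive definite quadratic form is strictly convex. -/
theorem Matrix.PosDef.quadratic_lt_of_add_eq_one {m : Type*} [Fintype m] {B : Matrix m m ℝ}
    (hB : B.PosDef) {x y : m → ℝ} (hxy : x ≠ y) {a b : ℝ} (ha : 0 < a) (hb : 0 < b)
    (hab : a + b = 1) :
    (a • x + b • y) ⬝ᵥ (B *ᵥ (a • x + b • y)) <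
      a * (x ⬝ᵥ (B *ᵥ x)) + b * (y ⬝ᵥ (B *ᵥ y)) := by
  have hpos : 0 < (x - y) ⬝ᵥ (B *ᵥ (x - y)) := by
    simpa using hB.dotProduct_mulVec_pos (sub_ne_zero.2 hxy)
  have hmul := mul_pos (mul_pos ha hb) hpos
  obtain rfl : b = 1 - a := by linarith
  simp only [mulVec_add, mulVec_sub, mulVec_smul, dotProduct_add, add_dotProduct, dotProduct_sub,
    sub_dotProduct, smul_dotProduct, dotProduct_smul, smul_eq_mul] at hmul ⊢
  linarith

section

variable {n N : ℕ} {M : Matrix (Fin N) (Fin N) ℝ} {H : (Fin n → ℝ) → Matrix (Fin N) (Fin N) ℝ}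

theorem posDef_mul_inv_mul (hM : M.PosDef) {A : Matrix (Fin N) (Fin N) ℝ} (hA : A.PosDef) :
    (M * A⁻¹ * M).PosDef := by
  have h := hA.inv.conjTranspose_mul_mul_same (B := M)
    (Matrix.mulVec_injective_iff_isUnit.2 hM.isUnit)
  rwa [hM.isHermitian.eq] at h

theorem continuous_lowerObj_s11 (u : Fin n → ℝ) : Continuous (lowerObj M H u) := by
  unfold lowerObj
  fun_prop

theorem analyticOnNhd_lowerObj {V : Set (Fin n → ℝ)}
    (hH : ∀ i j : Fin N, AnalyticOnNhd ℝ (fun u => H u i j) V)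
    (hdet : ∀ u ∈ V, (H u).det ≠ 0) (f : Fin N → ℝ) :
    AnalyticOnNhd ℝ (fun u => lowerObj M H u f) V := by
  simp only [lowerObj, dotProduct, mulVec, Matrix.mul_apply]
  exact Finset.analyticOnNhd_fun_sum _ fun i _ => analyticOnNhd_const.mul <|
    Finset.analyticOnNhd_fun_sum _ fun j _ => (Finset.analyticOnNhd_fun_sum _ fun k _ =>
      (Finset.analyticOnNhd_fun_sum _ fun l _ => analyticOnNhd_const.mul
        (AnalyticOnNhd.matrix_inv hH hdet l k)).mul analyticOnNhd_const).mul analyticOnNhd_const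

theorem mem_PsiSet_iff_isMaxOn {F : Set (Fin N → ℝ)} (hF : IsCompact F) {u : Fin n → ℝ}
    {f : Fin N → ℝ} :
    f ∈ PsiSet M H F u ↔ f ∈ F ∧ ∀ g ∈ F, lowerObj M H u g ≤ lowerObj M H u f := by
  have hbdd : BddAbove (lowerObj M H u '' F) :=
    (hF.image (continuous_lowerObj_s11 u)).bddAbove
  refine and_congr_right fun hf => ⟨fun h g hg => ?_, fun h => ?_⟩
  · rw [h]
    exact le_csSup hbdd (mem_image_of_mem _ hg)
  · exact ((IsGreatest.csSup_eq ⟨mem_image_of_mem _ hf, forall_mem_image.2 h⟩)).symm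

theorem PsiSet_nonempty {F : Set (Fin N → ℝ)} (hF : IsCompact F) (hne : F.Nonempty)
    (u : Fin n → ℝ) : (PsiSet M H F u).Nonempty := by
  obtain ⟨f, hf, hmax⟩ := hF.exists_isMaxOn hne
    (continuous_lowerObj_s11 (M := M) (H := H) u).continuousOn
  exact ⟨f, (mem_PsiSet_iff_isMaxOn hF).2 ⟨hf, fun g hg => hmax hg⟩⟩

theorem PsiSet_subset_extremePoints (hM : M.PosDef) {F : Set (Fin N → ℝ)} (hF : IsCompact F)
    {u : Fin n → ℝ} (hu : (H u).PosDef) : PsiSet M H F u ⊆ F.extremePoints ℝ := by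
  intro f hf
  obtain ⟨hfF, hmax⟩ := (mem_PsiSet_iff_isMaxOn hF).1 hf
  refine mem_extremePoints_iff_left.2 ⟨hfF, fun x hx y hy hxy => ?_⟩
  obtain ⟨a, b, ha, hb, hab, rfl⟩ := hxy
  by_contra hne
  have hxy' : x ≠ y := by
    rintro rfl
    exact hne (by rw [← add_smul, hab, one_smul])
  have hlt := (posDef_mul_inv_mul hM hu).quadratic_lt_of_add_eq_one hxy' ha hb hab
  have hx' := mul_le_mul_of_nonneg_left (hmax x hx) ha.le
  have hy' := mul_le_mul_of_nonneg_left (hmax y hy) hb.le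
  simp only [lowerObj] at hx' hy'
  have hsum := add_le_add hx' hy'
  rw [← add_mul, hab, one_mul] at hsum
  exact absurd hsum (not_le.2 hlt)

theorem mem_PsiSet_iff_extremePoints (hM : M.PosDef) {F : Set (Fin N → ℝ)} (hF : IsCompact F)
    {u : Fin n → ℝ} (hu : (H u).PosDef) {f : Fin N → ℝ} :
    f ∈ PsiSet M H F u ↔ f ∈ F.extremePoints ℝ ∧
      ∀ g ∈ F.extremePoints ℝ, lowerObj M H u g ≤ lowerObj M H u f := by
  refine ⟨fun hf => ⟨PsiSet_subset_extremePoints hM hF hu hf, fun g hg =>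
    ((mem_PsiSet_iff_isMaxOn hF).1 hf).2 g hg.1⟩, fun ⟨hf, hmax⟩ => ?_⟩
  obtain ⟨f', hf'⟩ := PsiSet_nonempty (M := M) (H := H) hF ⟨f, hf.1⟩ u
  have hle := hmax f' (PsiSet_subset_extremePoints hM hF hu hf')
  exact (mem_PsiSet_iff_isMaxOn hF).2 ⟨hf.1, fun g hg =>
    (((mem_PsiSet_iff_isMaxOn hF).1 hf').2 g hg).trans hle⟩

open Filter Topology in
/-- If the solution set is finite and locally constant at `u`, then the pessimistic value function
is continuous at `u`. -/
theorem continuousWithinAt_PhiVal_of_eventually_PsiSet_eq {F : Set (Fin N → ℝ)}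
    {U : Set (Fin n → ℝ)} {u : Fin n → ℝ} (hu : u ∈ U) {J : (Fin n → ℝ) → (Fin N → ℝ) → ℝ}
    (hJ : ∀ f, ContinuousWithinAt (fun v => J v f) U u)
    (hfin : (PsiSet M H F u).Finite) (hne : (PsiSet M H F u).Nonempty)
    (hev : ∀ᶠ v in 𝓝[U] u, PsiSet M H F v = PsiSet M H F u) :
    ContinuousWithinAt (PhiVal M H F J) U u := by
  lift PsiSet M H F u to Finset (Fin N → ℝ) using hfin with T hT
  have hTne : T.Nonempty := by simpa using hne
  have hcont : ContinuousWithinAt (fun v => T.sup' hTne (fun f => J v f)) U u :=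
    ContinuousWithinAt.finset_sup'_apply hTne fun f _ => hJ f
  refine hcont.congr_of_eventuallyEq_of_mem ?_ hu
  filter_upwards [hev] with v hv
  rw [PhiVal, hv, Finset.sup'_eq_csSup_image]

end

open MeasureTheory in
theorem stmt11 (n N : ℕ) (hn : 0 < n) (hN : 0 < N)
    (U : Set (Fin n → ℝ)) (hUpos : ∀ u ∈ U, ∀ i, 0 < u i)
    (hUne : U.Nonempty) (hUcl : IsClosed U)
    (M : Matrix (Fin N) (Fin N) ℝ) (hM : M.PosDef)
    (F : Set (Fin N → ℝ)) (hFne : F.Nonempty) (hFconv : Convex ℝ F)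
    (hFcomp : IsCompact F)
    (H : (Fin n → ℝ) → Matrix (Fin N) (Fin N) ℝ)
    (hHcont : ContinuousOn H U) (hHpd : ∀ u ∈ U, (H u).PosDef)
    -- ℱ is a bounded polyhedron: the convex hull of its nonempty finite
    -- set of extreme points 𝒫
    (P : Set (Fin N → ℝ)) (hPfin : P.Finite) (hPne : P.Nonempty)
    (hFP : F = convexHull ℝ P) (hPext : P = F.extremePoints ℝ)
    -- H is real analytic on an open connected set Ũ ⊇ 𝒰, with values in a
    -- closed subset of the symmetric positive definite matrices
    (Ut : Set (Fin n → ℝ)) (hUtopen : IsOpen Ut) (hUtconn : IsConnected Ut)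
    (hUUt : U ⊆ Ut)
    (hHana : ∀ i j : Fin N, AnalyticOnNhd ℝ (fun u => H u i j) Ut)
    (hHcl : ∃ C : Set (Matrix (Fin N) (Fin N) ℝ), IsClosed C ∧
      (∀ A ∈ C, A.PosDef) ∧ ∀ u ∈ Ut, H u ∈ C)
    (J : (Fin n → ℝ) → (Fin N → ℝ) → ℝ)
    (hJ : ContinuousOn (fun p : (Fin n → ℝ) × (Fin N → ℝ) => J p.1 p.2)
      (U ×ˢ Set.univ)) :
    volume {u : Fin n → ℝ |
      u ∈ U ∧ ¬ ContinuousWithinAt (PhiVal M H F J) U u} = 0 := by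
  obtain ⟨C, -, hCpd, hHC⟩ := hHcl
  have : Nonempty (Fin n) := ⟨⟨0, hn⟩⟩
  have hUtpd : ∀ u ∈ Ut, (H u).PosDef := fun u hu => hCpd _ (hHC u hu)
  have hana := analyticOnNhd_lowerObj (M := M) hHana fun u hu => (hUtpd u hu).det_pos.ne'
  let d : (Fin N → ℝ) × (Fin N → ℝ) → (Fin n → ℝ) → ℝ :=
    fun p u => lowerObj M H u p.2 - lowerObj M H u p.1
  have hd : ∀ p, AnalyticOnNhd ℝ (d p) Ut := fun p => (hana p.2).sub (hana p.1)
  let bad : Set ((Fin N → ℝ) × (Fin N → ℝ)) := {p ∈ P ×ˢ P | ¬ EqOn (d p) 0 Ut}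
  have hbad : bad.Countable := ((hPfin.prod hPfin).subset (sep_subset _ _)).countable
  refine measure_mono_null (t := ⋃ p ∈ bad, {u ∈ Ut | d p u = 0}) ?_
    ((measure_biUnion_null_iff hbad).2 fun p hp =>
      ((hd p).eqOn_zero_or_measure_zeros_eq_zero volume hUtopen
        hUtconn.isPreconnected).resolve_left hp.2)
  rintro u ⟨hu, hdisc⟩
  by_contra hgood
  have hgood' : ∀ p ∈ P ×ˢ P, EqOn (d p) 0 Ut ∨ d p u ≠ 0 := by
    intro p hp
    by_contra! hcon
    exact hgood (mem_biUnion (x := p) ⟨hp, hcon.1⟩ ⟨hUUt hu, hcon.2⟩)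
  have hpair : ∀ p ∈ P ×ˢ P, ∀ᶠ v in nhdsWithin u U, (d p v ≤ 0 ↔ d p u ≤ 0) := by
    intro p hp
    rcases hgood' p hp with h0 | h0
    · filter_upwards [self_mem_nhdsWithin] with v hv
      rw [h0 (hUUt hv), h0 (hUUt hu), Pi.zero_apply, Pi.zero_apply]
    · have hc : Filter.Tendsto (d p) (nhdsWithin u U) (nhds (d p u)) :=
        (hd p u (hUUt hu)).continuousAt.continuousWithinAt
      rcases lt_or_gt_of_ne h0 with hlt | hgt
      · filter_upwards [hc.eventually_lt_const hlt] with v hv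
        exact iff_of_true hv.le hlt.le
      · filter_upwards [hc.eventually_const_lt hgt] with v hv
        exact iff_of_false (not_le.2 hv) (not_le.2 hgt)
  refine hdisc (continuousWithinAt_PhiVal_of_eventually_PsiSet_eq hu (fun f => ?_) ?_
    (PsiSet_nonempty hFcomp hFne u) ?_)
  · exact (hJ (u, f) ⟨hu, mem_univ f⟩).comp (f := fun v => (v, f)) (by fun_prop)
      fun v hv => ⟨hv, mem_univ f⟩
  · exact hPfin.subset (hPext ▸ PsiSet_subset_extremePoints hM hFcomp (hHpd u hu))
  · filter_upwards [self_mem_nhdsWithin, (Filter.eventually_all_finite (hPfin.prod hPfin)).2 hpair]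
      with v hv hiff
    ext f
    rw [mem_PsiSet_iff_extremePoints hM hFcomp (hHpd v hv),
      mem_PsiSet_iff_extremePoints hM hFcomp (hHpd u hu), ← hPext]
    refine and_congr_right fun hf => forall₂_congr fun g hg => ?_
    simpa [d] using hiff (f, g) ⟨hf, hg⟩
end
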